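/- (Trivial fibration extension property) Let p : X → A be a trivial fibration of simplicial sets and let j : A → B be a monomorphism. Then there exist a trivial fibration q : Y → B and a map X → Y over j forming a pullback square, i.e., exhibiting X ≅ A ×_B Y over A. -/

import Mathlib

open CategoryTheory CategoryTheory.Limits Simplicial MonoidalCategory SSet

noncomputable instance : MonoidalClosed SSet.{0} :=
  (inferInstance : MonoidalClosed (SimplexCategoryᵒᵖ ⥤ Type 0))

namespace Paper

/-- A map of simplicial sets is a *trivial fibration* if it has the right lifting
property with respect to all boundary inclusions `∂Δ[n] ⟶ Δ[n]` for `n ≥ 0`. -/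
def TrivialFibration {X Y : SSet.{0}} (p : X ⟶ Y) : Prop :=
  ∀ n : ℕ, HasLiftingProperty (SSet.boundary n).ι p

/-- A map of simplicial sets is a *Kan fibration* if it has the right lifting property
with respect to all horn inclusions `Λ[n, i] ⟶ Δ[n]` for `n ≥ 1`, `0 ≤ i ≤ n`. -/
def KanFibration {X Y : SSet.{0}} (p : X ⟶ Y) : Prop :=
  ∀ (n : ℕ) (i : Fin (n + 2)), HasLiftingProperty (SSet.horn (n + 1) i).ι p

/-- An *anodyne* map is one with the left lifting property with respect to
all Kan fibrations. -/
def Anodyne {A B : SSet.{0}} (i : A ⟶ B) : Prop :=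
  ∀ ⦃X Y : SSet.{0}⦄ (p : X ⟶ Y), KanFibration p → HasLiftingProperty i p

/-- The unique map to `Δ[0]`. -/
def toPt (X : SSet.{0}) : X ⟶ Δ[0] where
  app m := TypeCat.ofHom fun _ => SSet.stdSimplex.const 0 0 m
  naturality := by
    intro m m' φ
    apply ConcreteCategory.hom_ext
    intro x
    apply stdSimplex.objEquiv.injective
    apply SimplexCategory.Hom.ext
    apply OrderHom.ext
    funext j
    exact @Subsingleton.elim (Fin 1) _ _ _

/-- A *Kan complex* is a simplicial set whose map to `Δ[0]` is a Kan fibration. -/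
def KanComplex (X : SSet.{0}) : Prop :=
  KanFibration (toPt X)

/-- The constant map at the vertex `k` of `Δ[1]`. -/
def cst (X : SSet.{0}) (k : Fin 2) : X ⟶ Δ[1] where
  app m := TypeCat.ofHom fun _ => SSet.stdSimplex.const 1 k m
  naturality := by
    intro m m' φ
    apply ConcreteCategory.hom_ext
    intro x
    apply stdSimplex.objEquiv.injective
    apply SimplexCategory.Hom.ext
    ext j
    rfl

/-- The endpoint inclusion `X ⟶ X ⊗ Δ[1]` at the vertex `k` of `Δ[1]`. -/
noncomputable def ept (X : SSet.{0}) (k : Fin 2) : X ⟶ X ⊗ Δ[1] :=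
  CartesianMonoidalCategory.lift (𝟙 X) (cst X k)

/-- A (single-step) homotopy from `f` to `g`, as a property of the pair `(f, g)`. -/
def Homotopy {X Y : SSet.{0}} (f g : X ⟶ Y) : Prop :=
  ∃ H : X ⊗ Δ[1] ⟶ Y, ept X 0 ≫ H = f ∧ ept X 1 ≫ H = g

/-- `f` and `g` are *homotopic* if they are connected by a zig-zag of homotopies. -/
def Homotopic {X Y : SSet.{0}} (f g : X ⟶ Y) : Prop :=
  Relation.EqvGen Homotopy f g

/-- A *homotopy equivalence* of simplicial sets. -/
def HomotopyEquivalence {X Y : SSet.{0}} (f : X ⟶ Y) : Prop :=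
  ∃ g : Y ⟶ X, Homotopic (f ≫ g) (𝟙 X) ∧ Homotopic (g ≫ f) (𝟙 Y)

/-- A map `f : X ⟶ Y` is a *weak homotopy equivalence* if for every Kan complex `K`
the induced map `K^Y ⟶ K^X` on exponentials is a homotopy equivalence. -/
def WeakHomotopyEquivalence {X Y : SSet.{0}} (f : X ⟶ Y) : Prop :=
  ∀ K : SSet.{0}, KanComplex K → HomotopyEquivalence ((MonoidalClosed.pre f).app K)

/-- A homotopy `H` between maps over `B` which is *fiberwise over `B`*. -/
def FibHomotopy {B X Y : SSet.{0}} (pX : X ⟶ B) (pY : Y ⟶ B) (f g : X ⟶ Y) : Prop :=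
  ∃ H : X ⊗ Δ[1] ⟶ Y, ept X 0 ≫ H = f ∧ ept X 1 ≫ H = g ∧
    H ≫ pY = CartesianMonoidalCategory.fst X Δ[1] ≫ pX

/-- Connectedness by a zig-zag of fiberwise homotopies over `B`. -/
def FibHomotopic {B X Y : SSet.{0}} (pX : X ⟶ B) (pY : Y ⟶ B) (f g : X ⟶ Y) : Prop :=
  Relation.EqvGen (FibHomotopy pX pY) f g

/-- A *fiberwise homotopy equivalence over `B`*. -/
def FibHomotopyEquivalence {B X Y : SSet.{0}} (pX : X ⟶ B) (pY : Y ⟶ B) (f : X ⟶ Y) : Prop :=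
  f ≫ pY = pX ∧ ∃ g : Y ⟶ X, g ≫ pX = pY ∧
    FibHomotopic pX pX (f ≫ g) (𝟙 X) ∧ FibHomotopic pY pY (g ≫ f) (𝟙 Y)

end Paper

namespace Paper

/-- An `n`-simplex of the pushforward of `p : X ⟶ A` along `j : A ⟶ B`: a simplex `b` of `B`
together with a section of `p` over the pullback of `b` along `j`. -/
structure PushforwardSimplex {X A B : SSet.{0}} (p : X ⟶ A) (j : A ⟶ B)
    (n : SimplexCategoryᵒᵖ) where
  base : B.obj n
  sec (m : SimplexCategoryᵒᵖ) (φ : n ⟶ m) (a : A.obj m) (h : j.app m a = B.map φ base) : X.obj m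
  app_sec (m : SimplexCategoryᵒᵖ) (φ : n ⟶ m) (a : A.obj m) (h : j.app m a = B.map φ base) :
    p.app m (sec m φ a h) = a
  map_sec (m m' : SimplexCategoryᵒᵖ) (φ : n ⟶ m) (ψ : m ⟶ m') (a : A.obj m)
    (h : j.app m a = B.map φ base) (h' : j.app m' (A.map ψ a) = B.map (φ ≫ ψ) base) :
    X.map ψ (sec m φ a h) = sec m' (φ ≫ ψ) (A.map ψ a) h'

namespace PushforwardSimplex

variable {X A B : SSet.{0}} {p : X ⟶ A} {j : A ⟶ B} {n : SimplexCategoryᵒᵖ}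

lemma ext_sec {y z : PushforwardSimplex p j n} (hb : y.base = z.base)
    (hs : ∀ m φ a h h', y.sec m φ a h = z.sec m φ a h') : y = z := by
  obtain ⟨b, s, _, _⟩ := y
  obtain ⟨c, t, _, _⟩ := z
  obtain rfl : b = c := hb
  obtain rfl : s = t := by
    funext m φ a h
    exact hs m φ a h h
  rfl

lemma sec_congr {y z : PushforwardSimplex p j n} (hyz : y = z) {m : SimplexCategoryᵒᵖ}
    {φ φ' : n ⟶ m} (hφ : φ = φ') {a a' : A.obj m} (ha : a = a')
    (h : j.app m a = B.map φ y.base) (h' : j.app m a' = B.map φ' z.base) :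
    y.sec m φ a h = z.sec m φ' a' h' := by
  subst hyz hφ ha
  rfl

/-- The action of simplicial operators on the simplices of the pushforward. -/
def restrict (y : PushforwardSimplex p j n) {n' : SimplexCategoryᵒᵖ} (ψ : n ⟶ n') :
    PushforwardSimplex p j n' where
  base := B.map ψ y.base
  sec m φ a h := y.sec m (ψ ≫ φ) a (by rw [h, Functor.map_comp_apply])
  app_sec m φ a h := y.app_sec _ _ _ _
  map_sec m m' φ χ a h h' := by
    rw [y.map_sec m m' (ψ ≫ φ) χ a _ (by
      rw [h', Category.assoc, Functor.map_comp_apply _ ψ])]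
    exact sec_congr rfl (Category.assoc _ _ _) rfl _ _

end PushforwardSimplex

section

variable {X A B : SSet.{0}} (p : X ⟶ A) (j : A ⟶ B)

/-- The pushforward (dependent product) of `p : X ⟶ A` along `j : A ⟶ B`. -/
def pushforward : SSet.{0} where
  obj n := PushforwardSimplex p j n
  map ψ := TypeCat.ofHom fun y => y.restrict ψ
  map_id n := by
    apply ConcreteCategory.hom_ext
    intro y
    exact PushforwardSimplex.ext_sec (Functor.map_id_apply B _ _)
      fun m φ a h h' => PushforwardSimplex.sec_congr rfl (Category.id_comp _) rfl _ _
  map_comp ψ χ := by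
    apply ConcreteCategory.hom_ext
    intro y
    exact PushforwardSimplex.ext_sec (Functor.map_comp_apply B _ _ _)
      fun m φ a h h' => PushforwardSimplex.sec_congr rfl (Category.assoc _ _ _) rfl _ _

/-- The projection of the pushforward onto the base. -/
def pushforwardProj : pushforward p j ⟶ B where
  app _ := TypeCat.ofHom fun y => PushforwardSimplex.base y
  naturality _ _ _ := rfl

/-- For a monomorphism `j`, the canonical map from `X` to the pushforward of `p : X ⟶ A`. -/
def toPushforward [Mono j] : X ⟶ pushforward p j where
  app n := TypeCat.ofHom fun x =>
    { base := j.app n (p.app n x)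
      sec := fun m φ _ _ => X.map φ x
      app_sec := fun m φ a h => by
        have hj : Function.Injective (j.app m) := (mono_iff_injective _).1 inferInstance
        apply hj
        rw [h, NatTrans.naturality_apply, NatTrans.naturality_apply]
      map_sec := fun m m' φ ψ a h h' => (Functor.map_comp_apply X _ _ _).symm }
  naturality n n' ψ := by
    apply ConcreteCategory.hom_ext
    intro x
    refine PushforwardSimplex.ext_sec ?_ fun m φ a h h' =>
      (Functor.map_comp_apply X _ _ _).symm
    change j.app n' (p.app n' (X.map ψ x)) = B.map ψ (j.app n (p.app n x))
    rw [NatTrans.naturality_apply, NatTrans.naturality_apply]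

lemma isPullback_pushforward [Mono j] :
    IsPullback p (toPushforward p j) j (pushforwardProj p j) := by
  refine IsPullback.of_forall_isPullback_app fun n => ?_
  rw [Types.isPullback_iff]
  refine ⟨rfl, ?_, ?_⟩
  · rintro x x' ⟨-, hu⟩
    have h := PushforwardSimplex.sec_congr hu (Eq.refl (𝟙 n)) (Eq.refl (p.app n x))
      (Functor.map_id_apply B _ _).symm (by
        rw [← hu]
        exact (Functor.map_id_apply B _ _).symm)
    have hx : X.map (𝟙 n) x = X.map (𝟙 n) x' := h
    rwa [Functor.map_id_apply, Functor.map_id_apply] at hx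
  · intro a y (hy : j.app n a = y.base)
    have hid : j.app n a = B.map (𝟙 n) y.base := by rw [Functor.map_id_apply, hy]
    have hpa : p.app n (y.sec n (𝟙 n) a hid) = a := y.app_sec _ _ _ _
    refine ⟨y.sec n (𝟙 n) a hid, hpa,
      PushforwardSimplex.ext_sec ((congrArg (j.app n) hpa).trans hy) fun m φ a' h h' => ?_⟩
    have hj : Function.Injective (j.app m) := (mono_iff_injective _).1 inferInstance
    have ha : A.map φ a = a' := by
      apply hj
      rw [NatTrans.naturality_apply, hy, h']
    refine (y.map_sec _ _ _ φ _ _ ?_).trans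
      (PushforwardSimplex.sec_congr rfl (Category.id_comp φ) ha _ _)
    rw [ha, h', Category.id_comp]

/-- The fibre product of `k : K ⟶ B` and `j : A ⟶ B`. -/
def fibreProduct {K : SSet.{0}} (k : K ⟶ B) : SSet.{0} where
  obj n := { x : K.obj n × A.obj n // j.app n x.2 = k.app n x.1 }
  map ψ := TypeCat.ofHom fun x => ⟨(K.map ψ x.1.1, A.map ψ x.1.2), by
    dsimp only
    rw [NatTrans.naturality_apply, NatTrans.naturality_apply, x.2]⟩
  map_id n := by
    apply ConcreteCategory.hom_ext
    intro x
    exact Subtype.ext (Prod.ext (Functor.map_id_apply K _ _)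
      (Functor.map_id_apply A _ _))
  map_comp ψ χ := by
    apply ConcreteCategory.hom_ext
    intro x
    exact Subtype.ext (Prod.ext (Functor.map_comp_apply K _ _ _)
      (Functor.map_comp_apply A _ _ _))

/-- The projection of the fibre product onto its second factor. -/
def fibreProductSnd {K : SSet.{0}} (k : K ⟶ B) : fibreProduct j k ⟶ A where
  app _ := TypeCat.ofHom fun x => x.1.2
  naturality _ _ _ := rfl

/-- The map on fibre products induced by a map over the base. -/
def fibreProductMap {K L : SSet.{0}} (i : K ⟶ L) (k : K ⟶ B) (l : L ⟶ B) (w : i ≫ l = k) :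
    fibreProduct j k ⟶ fibreProduct j l where
  app n := TypeCat.ofHom fun x => ⟨(i.app n x.1.1, x.1.2), by
    subst w
    exact x.2⟩
  naturality n n' ψ := by
    apply ConcreteCategory.hom_ext
    intro x
    have h : i.app n' (K.map ψ x.1.1) = L.map ψ (i.app n x.1.1) :=
      NatTrans.naturality_apply i ψ x.1.1
    exact Subtype.ext (Prod.ext h rfl)

instance mono_fibreProductMap {K L : SSet.{0}} (i : K ⟶ L) [Mono i] (k : K ⟶ B) (l : L ⟶ B)
    (w : i ≫ l = k) : Mono (fibreProductMap j i k l w) := by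
  rw [NatTrans.mono_iff_mono_app]
  intro n
  rw [mono_iff_injective]
  intro x y hxy
  have hi : Function.Injective (i.app n) := (mono_iff_injective _).1 inferInstance
  have h₁ : i.app n x.1.1 = i.app n y.1.1 :=
    congrArg (fun z : (fibreProduct j l).obj n => z.1.1) hxy
  have h₂ : x.1.2 = y.1.2 := congrArg (fun z : (fibreProduct j l).obj n => z.1.2) hxy
  exact Subtype.ext (Prod.ext (hi h₁) h₂)

/-- The map from the fibre product to `X` corresponding to a map to the pushforward. -/
def ofPushforward {K : SSet.{0}} (f : K ⟶ pushforward p j) :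
    fibreProduct j (f ≫ pushforwardProj p j) ⟶ X where
  app n := TypeCat.ofHom fun x =>
    PushforwardSimplex.sec (f.app n x.1.1) n (𝟙 n) x.1.2 (by
      rw [Functor.map_id_apply]
      exact x.2)
  naturality n n' ψ := by
    apply ConcreteCategory.hom_ext
    intro x
    refine Eq.trans ?_ (PushforwardSimplex.map_sec _ _ _ (𝟙 n) ψ _ _ ?_).symm
    · refine (PushforwardSimplex.sec_congr (NatTrans.naturality_apply f ψ x.1.1) rfl rfl _ ?_).trans
        (PushforwardSimplex.sec_congr rfl ((Category.comp_id ψ).trans (Category.id_comp ψ).symm)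
          rfl _ _)
      rw [Functor.map_id_apply]
      exact (NatTrans.naturality_apply j ψ x.1.2).trans (congrArg (B.map ψ) x.2)
    · rw [Category.id_comp]
      exact (NatTrans.naturality_apply j ψ x.1.2).trans (congrArg (B.map ψ) x.2)

/-- The map to the pushforward corresponding to a map over `A` from the fibre product to `X`. -/
def liftPushforward {K : SSet.{0}} (k : K ⟶ B) (s : fibreProduct j k ⟶ X)
    (w : s ≫ p = fibreProductSnd j k) : K ⟶ pushforward p j where
  app n := TypeCat.ofHom fun x =>
    { base := k.app n x
      sec := fun m φ a h => s.app m ⟨(K.map φ x, a), by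
        rw [h, NatTrans.naturality_apply]⟩
      app_sec := fun m φ a h => ConcreteCategory.congr_hom (NatTrans.congr_app w m) _
      map_sec := fun m m' φ ψ a h h' => by
        exact (NatTrans.naturality_apply s ψ _).symm.trans (congrArg (s.app m')
          (Subtype.ext (Prod.ext (Functor.map_comp_apply K _ _ _).symm rfl))) }
  naturality n n' ψ := by
    apply ConcreteCategory.hom_ext
    intro x
    have hb : k.app n' (K.map ψ x) = B.map ψ (k.app n x) := NatTrans.naturality_apply k ψ x
    exact PushforwardSimplex.ext_sec hb fun m φ a h h' =>
      congrArg (s.app m)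
        (Subtype.ext (Prod.ext (Functor.map_comp_apply K _ _ _).symm rfl))

lemma hasLiftingProperty_pushforwardProj
    (hp : (MorphismProperty.monomorphisms SSet.{0}).rlp p) :
    (MorphismProperty.monomorphisms SSet.{0}).rlp (pushforwardProj p j) := by
  intro K L i hi
  have : Mono i := hi
  refine ⟨fun {f g} sq => ?_⟩
  have : HasLiftingProperty (fibreProductMap j i (f ≫ pushforwardProj p j) g sq.w.symm) p :=
    hp _ (MorphismProperty.monomorphisms.infer_property _)
  have sq' : CommSq (ofPushforward p j f)
      (fibreProductMap j i (f ≫ pushforwardProj p j) g sq.w.symm) p (fibreProductSnd j g) := by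
    refine ⟨?_⟩
    apply NatTrans.ext
    funext n
    apply ConcreteCategory.hom_ext
    intro x
    exact PushforwardSimplex.app_sec _ _ _ _ _
  refine ⟨⟨⟨liftPushforward p j g sq'.lift sq'.fac_right, ?_, rfl⟩⟩⟩
  apply NatTrans.ext
  funext n
  apply ConcreteCategory.hom_ext
  intro x
  have hb : g.app n (i.app n x) = (f.app n x).base :=
    (ConcreteCategory.congr_hom (NatTrans.congr_app sq.w n) x).symm
  refine PushforwardSimplex.ext_sec hb fun m φ a h h' => ?_
  have e := ConcreteCategory.congr_hom (NatTrans.congr_app sq'.fac_left m) ⟨(K.map φ x, a), by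
    rw [h', NatTrans.naturality_apply]
    rfl⟩
  refine Eq.trans ?_ (e.trans ?_)
  · exact congrArg (sq'.lift.app m)
      (Subtype.ext (Prod.ext (NatTrans.naturality_apply i φ x).symm rfl))
  · exact (PushforwardSimplex.sec_congr (NatTrans.naturality_apply f φ x) rfl (Eq.refl a) _ (by
      rw [Functor.map_id_apply]
      exact h')).trans
        (PushforwardSimplex.sec_congr rfl (Category.comp_id φ) rfl _ _)

end

lemma trivialFibration_iff_rlp {X Y : SSet.{0}} (p : X ⟶ Y) :
    TrivialFibration p ↔ (MorphismProperty.monomorphisms SSet.{0}).rlp p := by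
  rw [SSet.rlp_monomorphisms]
  constructor
  · rintro hp _ _ _ ⟨n⟩
    exact hp n
  · intro hp n
    exact hp _ (SSet.modelCategoryQuillen.boundary_ι_mem_I n)

end Paper

/-- Trivial fibration extension property. Trivial fibrations extend
along monomorphisms. -/
theorem trivial_fibration_extension {X A B : SSet.{0}} (p : X ⟶ A)
    (hp : Paper.TrivialFibration p) (j : A ⟶ B) (hj : Mono j) :
    ∃ (Y : SSet.{0}) (q : Y ⟶ B) (u : X ⟶ Y),
      Paper.TrivialFibration q ∧ IsPullback p u j q := by
  refine ⟨Paper.pushforward p j, Paper.pushforwardProj p j, Paper.toPushforward p j, ?_,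
    Paper.isPullback_pushforward p j⟩
  rw [Paper.trivialFibration_iff_rlp] at hp ⊢
  exact Paper.hasLiftingProperty_pushforwardProj p j hp
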